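/- Let K be a field extension of a field F, let n ≥ 1, let 𝒜 ≤ Λ(n,F) be an alternating matrix space, and let 𝒜_K ≤ Λ(n,K) be the K-linear span of 𝒜 (i.e., 𝒜 ⊗_F K, regarding the matrices of 𝒜 as matrices over K). Then α(𝒜) ≤ α(𝒜_K) and χ(𝒜) ≥ χ(𝒜_K). -/

import Mathlib

open Matrix

namespace Submodule

variable {F K : Type*} [Field F] [Field K] [Algebra F K] {ι : Type*}

/-- The coordinatewise embedding `F^ι → K^ι` of a field extension. -/
noncomputable def piScalarMap (F K : Type*) [Field F] [Field K] [Algebra F K] (ι : Type*) :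
    (ι → F) →ₗ[F] (ι → K) :=
  (Algebra.linearMap F K).compLeft ι

@[simp]
theorem piScalarMap_apply (v : ι → F) (i : ι) :
    piScalarMap F K ι v i = algebraMap F K (v i) := rfl

/-- The extension of scalars of a subspace of `F^ι`, as a subspace of `K^ι`. -/
noncomputable def piExtend (K : Type*) [Field K] [Algebra F K] (U : Submodule F (ι → F)) :
    Submodule K (ι → K) :=
  span K (piScalarMap F K ι '' U)

theorem piScalarMap_mem_piExtend {U : Submodule F (ι → F)} {u : ι → F} (hu : u ∈ U) :
    piScalarMap F K ι u ∈ piExtend K U :=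
  subset_span ⟨u, hu, rfl⟩

theorem piExtend_ne_bot {U : Submodule F (ι → F)} (hU : U ≠ ⊥) : piExtend K U ≠ ⊥ := by
  obtain ⟨u, hu, hu0⟩ := exists_mem_ne_zero_of_ne_bot hU
  intro h
  have hmem := piScalarMap_mem_piExtend (K := K) hu
  rw [h, mem_bot] at hmem
  refine hu0 (funext fun i => ?_)
  simpa using congrFun hmem i

theorem piExtend_span (s : Set (ι → F)) :
    piExtend K (span F s) = span K (piScalarMap F K ι '' s) := by
  rw [piExtend, ← map_coe, map_span, span_span_of_tower]

theorem finrank_piExtend_le [Finite ι] (U : Submodule F (ι → F)) :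
    Module.finrank K (piExtend K U) ≤ Module.finrank F U := by
  let b := Module.finBasis F U
  have hspan : span F (Set.range fun i => (b i : ι → F)) = U := by
    have h := congrArg (map U.subtype) b.span_eq
    rwa [map_span, ← Set.range_comp, map_subtype_top] at h
  have hrange : piExtend K U =
      span K (Set.range fun i => piScalarMap F K ι (b i)) := by
    conv_lhs => rw [← hspan, piExtend_span, ← Set.range_comp]
    rfl
  rw [hrange]
  simpa [Set.finrank] using finrank_range_le_card (R := K) fun i => piScalarMap F K ι (b i)

theorem iSup_piExtend_eq_top [Finite ι] {κ : Type*} {U : κ → Submodule F (ι → F)}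
    (hU : ⨆ k, U k = ⊤) : ⨆ k, piExtend K (U k) = ⊤ := by
  classical
  have hle : ⨆ k, U k ≤
      ((⨆ k, piExtend K (U k)).restrictScalars F).comap (piScalarMap F K ι) :=
    iSup_le fun k _ hu => mem_iSup_of_mem k (piScalarMap_mem_piExtend hu)
  rw [eq_top_iff, ← (Pi.basisFun K ι).span_eq, span_le]
  rintro _ ⟨i, rfl⟩
  have hi : piScalarMap F K ι (Pi.single i 1) ∈ ⨆ k, piExtend K (U k) :=
    hle (hU ▸ mem_top)
  suffices h : Pi.basisFun K ι i = piScalarMap F K ι (Pi.single i 1) from h ▸ hi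
  ext j
  by_cases h : j = i
  · subst h; simp
  · simp [h]

theorem finrank_piExtend [Finite ι] (U : Submodule F (ι → F)) :
    Module.finrank K (piExtend K U) = Module.finrank F U := by
  have := Fintype.ofFinite ι
  refine (finrank_piExtend_le U).antisymm ?_
  obtain ⟨W, hW⟩ := exists_isCompl U
  have hsup : piExtend K U ⊔ piExtend K W = ⊤ := by
    have h := iSup_piExtend_eq_top (K := K) (U := fun b : Bool => cond b U W)
      (by rw [iSup_bool_eq]; exact hW.sup_eq_top)
    rwa [iSup_bool_eq] at h
  have hK := finrank_add_le_finrank_add_finrank (piExtend K U) (piExtend K W)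
  rw [hsup, finrank_top, Module.finrank_fintype_fun_eq_card] at hK
  have hF := finrank_add_eq_of_isCompl hW
  rw [Module.finrank_fintype_fun_eq_card] at hF
  have := finrank_piExtend_le (K := K) W
  omega

theorem isInternal_piExtend [Finite ι] {κ : Type*} [Fintype κ] [DecidableEq κ]
    {U : κ → Submodule F (ι → F)} (hU : DirectSum.IsInternal U) :
    DirectSum.IsInternal fun k => piExtend K (U k) := by
  have := Fintype.ofFinite ι
  have hsurj : Function.Surjective (DirectSum.coeLinearMap fun k => piExtend K (U k)) := by
    rw [← LinearMap.range_eq_top, DirectSum.range_coeLinearMap]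
    exact iSup_piExtend_eq_top hU.submodule_iSup_eq_top
  have hF := (LinearEquiv.ofBijective (DirectSum.coeLinearMap U) hU).finrank_eq
  have hdim : Module.finrank K (DirectSum κ fun k => piExtend K (U k)) =
      Module.finrank K (ι → K) := by
    rw [Module.finrank_directSum, Module.finrank_fintype_fun_eq_card] at hF ⊢
    simpa only [finrank_piExtend] using hF
  have hinj : Function.Injective (DirectSum.coeLinearMap fun k => piExtend K (U k)) :=
    OrzechProperty.injective_of_surjective_of_injective
      (LinearEquiv.ofFinrankEq _ _ hdim).toLinearMap _ (LinearEquiv.injective _) hsurj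
  exact ⟨hinj, hsurj⟩

theorem isotropic_piExtend [Fintype ι] {𝒜 : Submodule F (Matrix ι ι F)}
    {U : Submodule F (ι → F)} (hU : ∀ u ∈ U, ∀ u' ∈ U, ∀ A ∈ 𝒜, u ⬝ᵥ A *ᵥ u' = 0) :
    ∀ u ∈ piExtend K U, ∀ u' ∈ piExtend K U,
      ∀ A ∈ span K ((fun A : Matrix ι ι F => A.map (algebraMap F K)) '' (𝒜 : Set _)),
        u ⬝ᵥ A *ᵥ u' = 0 := by
  intro u hu u' hu' A hA
  induction hA using span_induction with
  | zero => simp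
  | add A B _ _ hA hB => rw [add_mulVec, dotProduct_add, hA, hB, add_zero]
  | smul c A _ hA => rw [smul_mulVec, dotProduct_smul, hA, smul_zero]
  | mem A hA =>
    obtain ⟨A, hA, rfl⟩ := hA
    induction hu using span_induction with
    | zero => simp
    | add x y _ _ hx hy => rw [add_dotProduct, hx, hy, add_zero]
    | smul c x _ hx => rw [smul_dotProduct, hx, smul_zero]
    | mem x hx =>
      obtain ⟨x, hx, rfl⟩ := hx
      induction hu' using span_induction with
      | zero => simp
      | add y z _ _ hy hz => rw [mulVec_add, dotProduct_add, hy, hz, add_zero]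
      | smul c y _ hy => rw [mulVec_smul, dotProduct_smul, hy, smul_zero]
      | mem y hy =>
        obtain ⟨y, hy, rfl⟩ := hy
        have h := congrArg (algebraMap F K) (hU x hx y hy A hA)
        simpa [dotProduct, mulVec] using h

/-- The coordinate lines form a direct sum decomposition. -/
theorem isInternal_span_single (F : Type*) [Field F] (ι : Type*) [Finite ι] [DecidableEq ι] :
    DirectSum.IsInternal fun i : ι => span F {(Pi.single i 1 : ι → F)} := by
  have h : ∀ i, (Pi.single i 1 : ι → F) = Pi.basisFun F ι i := by simp
  simp only [h]
  rw [DirectSum.isInternal_submodule_iff_iSupIndep_and_iSup_eq_top]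
  refine ⟨(Pi.basisFun F ι).linearIndependent.iSupIndep_span_singleton, ?_⟩
  rw [← span_range_eq_iSup, (Pi.basisFun F ι).span_eq]

end Submodule

/-- For a field extension `K/F`, `n ≥ 1`, and an alternating matrix space
`𝒜 ≤ Λ(n,F)` with `𝒜_K ≤ Λ(n,K)` its `K`-linear span, one has
`α(𝒜) ≤ α(𝒜_K)` and `χ(𝒜) ≥ χ(𝒜_K)`. -/
theorem stmt_4 (F K : Type) [Field F] [Field K] [Algebra F K] (n : ℕ) (hn : 1 ≤ n)
    (𝒜 : Submodule F (Matrix (Fin n) (Fin n) F))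
    (halt : ∀ A ∈ 𝒜, ∀ v : Fin n → F, v ⬝ᵥ A *ᵥ v = 0)
    (𝒜K : Submodule K (Matrix (Fin n) (Fin n) K))
    (h𝒜K : 𝒜K = Submodule.span K
      ((fun A : Matrix (Fin n) (Fin n) F => A.map (algebraMap F K)) '' (𝒜 : Set _))) :
    sSup {d : ℕ | ∃ U : Submodule F (Fin n → F),
        (∀ u ∈ U, ∀ u' ∈ U, ∀ A ∈ 𝒜, u ⬝ᵥ A *ᵥ u' = 0) ∧ Module.finrank F U = d}
      ≤ sSup {d : ℕ | ∃ U : Submodule K (Fin n → K),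
        (∀ u ∈ U, ∀ u' ∈ U, ∀ A ∈ 𝒜K, u ⬝ᵥ A *ᵥ u' = 0) ∧ Module.finrank K U = d}
    ∧ sInf {c : ℕ | ∃ U : Fin c → Submodule K (Fin n → K),
        (∀ i, U i ≠ ⊥) ∧
        (∀ i, ∀ u ∈ U i, ∀ u' ∈ U i, ∀ A ∈ 𝒜K, u ⬝ᵥ A *ᵥ u' = 0) ∧
        DirectSum.IsInternal U}
      ≤ sInf {c : ℕ | ∃ U : Fin c → Submodule F (Fin n → F),
        (∀ i, U i ≠ ⊥) ∧
        (∀ i, ∀ u ∈ U i, ∀ u' ∈ U i, ∀ A ∈ 𝒜, u ⬝ᵥ A *ᵥ u' = 0) ∧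
        DirectSum.IsInternal U} := by
  subst h𝒜K
  refine ⟨csSup_le_csSup ⟨n, ?_⟩ ⟨0, ⊥, by simp, by simp⟩ ?_,
    csInf_le_csInf (OrderBot.bddBelow _) ?_ ?_⟩
  · rintro _ ⟨U, -, rfl⟩
    simpa using U.finrank_le
  · rintro _ ⟨U, hU, rfl⟩
    exact ⟨U.piExtend K, Submodule.isotropic_piExtend hU, Submodule.finrank_piExtend U⟩
  · refine ⟨n, fun i => Submodule.span F {Pi.single i 1}, fun i => by simp, fun i => ?_,
      Submodule.isInternal_span_single F (Fin n)⟩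
    intro u hu u' hu' A hA
    obtain ⟨a, rfl⟩ := Submodule.mem_span_singleton.1 hu
    obtain ⟨b, rfl⟩ := Submodule.mem_span_singleton.1 hu'
    rw [mulVec_smul, smul_dotProduct, dotProduct_smul, halt A hA, smul_zero, smul_zero]
  · rintro c ⟨U, hne, hU, hint⟩
    exact ⟨fun i => (U i).piExtend K, fun i => Submodule.piExtend_ne_bot (hne i),
      fun i => Submodule.isotropic_piExtend (hU i), Submodule.isInternal_piExtend hint⟩
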